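/- Let G be a finite simple triangle-free graph. Then Ψ(G) is a greedoid on the vertex set of G if and only if all maximum matchings of G are uniquely restricted and, for every local maximum stable set S of G, the subgraph of G induced by N[S] is a König-Egerváry graph. -/

import Mathlib

open Classical

variable {V : Type*} [Fintype V] [DecidableEq V]

/-- `S` is a stable (independent) set of vertices in `G`. -/
def IsStable (G : SimpleGraph V) (S : Finset V) : Prop :=
  ∀ ⦃x⦄, x ∈ S → ∀ ⦃y⦄, y ∈ S → ¬G.Adj x y

/-- The open neighborhood `N(S)`: vertices outside `S` having a neighbor in `S`. -/
noncomputable def nbhd (G : SimpleGraph V) (S : Finset V) : Finset V :=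
  Finset.univ.filter fun v => v ∉ S ∧ ∃ u ∈ S, G.Adj u v

/-- The closed neighborhood `N[S] = S ∪ N(S)`. -/
noncomputable def closedNbhd (G : SimpleGraph V) (S : Finset V) : Finset V :=
  S ∪ nbhd G S

/-- The stability (independence) number of the subgraph of `G` induced by `A`. -/
noncomputable def alphaOn (G : SimpleGraph V) (A : Finset V) : ℕ :=
  sSup {n | ∃ S ⊆ A, IsStable G S ∧ S.card = n}

/-- The stability (independence) number `α(G)`. -/
noncomputable def alpha (G : SimpleGraph V) : ℕ :=
  alphaOn G Finset.univ

/-- `S` is a maximum stable set of the subgraph of `G` induced by `N[S]`. -/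
def IsLocalMaxStable (G : SimpleGraph V) (S : Finset V) : Prop :=
  IsStable G S ∧ S.card = alphaOn G (closedNbhd G S)

/-- `Ψ(G)`: the family of all local maximum stable sets of `G`. -/
def Psi (G : SimpleGraph V) : Set (Finset V) :=
  {S | IsLocalMaxStable G S}

/-- A matching of `G`: a set of pairwise disjoint edges of `G`. -/
def IsGMatching (G : SimpleGraph V) (M : Finset (Sym2 V)) : Prop :=
  (∀ e ∈ M, e ∈ G.edgeSet) ∧
    ∀ e ∈ M, ∀ f ∈ M, e ≠ f → ∀ v : V, v ∈ e → v ∉ f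

/-- A matching of `G` all of whose edges have both endpoints inside `A`,
i.e. a matching of the subgraph of `G` induced by `A`. -/
def IsGMatchingOn (G : SimpleGraph V) (A : Finset V) (M : Finset (Sym2 V)) : Prop :=
  IsGMatching G M ∧ ∀ e ∈ M, ∀ v : V, v ∈ e → v ∈ A

/-- The matching number of the subgraph of `G` induced by `A`. -/
noncomputable def muOn (G : SimpleGraph V) (A : Finset V) : ℕ :=
  sSup {n | ∃ M, IsGMatchingOn G A M ∧ M.card = n}

/-- The matching number `μ(G)`. -/
noncomputable def mu (G : SimpleGraph V) : ℕ :=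
  muOn G Finset.univ

/-- A maximum matching of `G`. -/
def IsMaximumGMatching (G : SimpleGraph V) (M : Finset (Sym2 V)) : Prop :=
  IsGMatching G M ∧ M.card = mu G

/-- The matching `M` saturates the vertex `v`. -/
def MSaturates (M : Finset (Sym2 V)) (v : V) : Prop :=
  ∃ e ∈ M, v ∈ e

/-- A perfect matching of `G`: a matching saturating every vertex. -/
def IsPerfectGMatching (G : SimpleGraph V) (M : Finset (Sym2 V)) : Prop :=
  IsGMatching G M ∧ ∀ v : V, MSaturates M v

/-- The set of vertices saturated by `M`. -/
noncomputable def msupp (M : Finset (Sym2 V)) : Finset V :=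
  Finset.univ.filter fun v => ∃ e ∈ M, v ∈ e

/-- `M` is a uniquely restricted matching: it is the unique perfect matching of
the subgraph of `G` induced by the set of vertices saturated by `M`. -/
def UniquelyRestricted (G : SimpleGraph V) (M : Finset (Sym2 V)) : Prop :=
  IsGMatching G M ∧
    ∀ M' : Finset (Sym2 V), IsGMatchingOn G (msupp M) M' →
      (∀ v ∈ msupp M, MSaturates M' v) → M' = M

/-- Accessibility property of a set system. -/
def AccessibleFam (F : Set (Finset V)) : Prop :=
  ∀ X ∈ F, X ≠ ∅ → ∃ x ∈ X, X.erase x ∈ F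

/-- Exchange property of a set system. -/
def ExchangeFam (F : Set (Finset V)) : Prop :=
  ∀ X ∈ F, ∀ Y ∈ F, X.card = Y.card + 1 → ∃ x ∈ X, x ∉ Y ∧ insert x Y ∈ F

/-- A greedoid: a nonempty set system satisfying accessibility and exchange. -/
def IsGreedoidFam (F : Set (Finset V)) : Prop :=
  F.Nonempty ∧ AccessibleFam F ∧ ExchangeFam F

/-- A maximal stable set. -/
def IsMaximalStable (G : SimpleGraph V) (S : Finset V) : Prop :=
  IsStable G S ∧ ∀ T, IsStable G T → S ⊆ T → S = T

/-- `G` is well-covered: all maximal stable sets have the same cardinality. -/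
def WellCovered (G : SimpleGraph V) : Prop :=
  ∀ S T, IsMaximalStable G S → IsMaximalStable G T → S.card = T.card

/-- `G` is very well-covered: well-covered, no isolated vertices, `|V| = 2α(G)`. -/
def VeryWellCovered (G : SimpleGraph V) : Prop :=
  WellCovered G ∧ (∀ v : V, ∃ u, G.Adj v u) ∧ Fintype.card V = 2 * alpha G

/-- The subgraph of `G` induced by `A` is a König-Egerváry graph. -/
def KonigEgervaryOn (G : SimpleGraph V) (A : Finset V) : Prop :=
  alphaOn G A + muOn G A = A.card

/-- `G` is a König-Egerváry graph: `α(G) + μ(G) = |V(G)|`. -/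
def KonigEgervary (G : SimpleGraph V) : Prop :=
  alpha G + mu G = Fintype.card V

/-- The cycle `c` is alternating with respect to `M`: of every two incident
edges of `c` exactly one belongs to `M`. -/
def IsAlternatingCycle (G : SimpleGraph V) (M : Finset (Sym2 V)) {v : V}
    (c : G.Walk v v) : Prop :=
  c.IsCycle ∧ ∀ e ∈ c.edges, ∀ f ∈ c.edges, e ≠ f →
    (∃ u : V, u ∈ e ∧ u ∈ f) → (e ∈ M ↔ f ∉ M)

/-- `G` contains an `M`-alternating cycle. -/
def HasAlternatingCycle (G : SimpleGraph V) (M : Finset (Sym2 V)) : Prop :=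
  ∃ (v : V) (c : G.Walk v v), IsAlternatingCycle G M c

/-- The cycle `c` is chordless: the subgraph induced by its vertices has no
edges other than the cycle edges. -/
def ChordlessCycle (G : SimpleGraph V) {v : V} (c : G.Walk v v) : Prop :=
  ∀ x ∈ c.support, ∀ y ∈ c.support, G.Adj x y → s(x, y) ∈ c.edges

section StableSets

variable {G : SimpleGraph V} {S T A : Finset V} {f : V → V}

lemma mem_nbhd {v : V} : v ∈ nbhd G S ↔ v ∉ S ∧ ∃ u ∈ S, G.Adj u v := by
  simp [nbhd]

lemma mem_closedNbhd {v : V} : v ∈ closedNbhd G S ↔ v ∈ S ∨ v ∈ nbhd G S := by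
  simp [closedNbhd]

lemma IsStable.mem_nbhd_of_adj (hS : IsStable G S) {u v : V} (hu : u ∈ S) (h : G.Adj u v) :
    v ∈ nbhd G S :=
  mem_nbhd.2 ⟨fun hv => hS hu hv h, u, hu, h⟩

lemma IsStable.mono (hT : IsStable G T) (h : S ⊆ T) : IsStable G S :=
  fun _ hx _ hy => hT (h hx) (h hy)

lemma IsStable.insert_vertex {x : V} (hS : IsStable G S) (hx : x ∉ nbhd G S) (hxS : x ∉ S) :
    IsStable G (insert x S) := by
  have key : ∀ y ∈ S, ¬ G.Adj y x := fun y hy h => hx (mem_nbhd.2 ⟨hxS, y, hy, h⟩)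
  intro a ha b hb hab
  rcases Finset.mem_insert.1 ha with rfl | ha' <;> rcases Finset.mem_insert.1 hb with rfl | hb'
  · exact G.loopless.irrefl _ hab
  · exact key b hb' hab.symm
  · exact key a ha' hab
  · exact hS ha' hb' hab

lemma bddAbove_stable_card (G : SimpleGraph V) (A : Finset V) :
    BddAbove {n | ∃ S ⊆ A, IsStable G S ∧ S.card = n} := by
  refine ⟨A.card, ?_⟩
  rintro n ⟨S, hS, -, rfl⟩
  exact Finset.card_le_card hS

lemma IsStable.card_le_alphaOn (hS : IsStable G S) (h : S ⊆ A) : S.card ≤ alphaOn G A :=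
  le_csSup (bddAbove_stable_card G A) ⟨S, h, hS, rfl⟩

lemma exists_card_eq_alphaOn (G : SimpleGraph V) (A : Finset V) :
    ∃ S ⊆ A, IsStable G S ∧ S.card = alphaOn G A :=
  Nat.sSup_mem (s := {n | ∃ S ⊆ A, IsStable G S ∧ S.card = n})
    ⟨0, ∅, by simp, fun x hx => by simp at hx, rfl⟩ (bddAbove_stable_card G A)

lemma mem_Psi_iff :
    S ∈ Psi G ↔ IsStable G S ∧ ∀ T ⊆ closedNbhd G S, IsStable G T → T.card ≤ S.card := by
  constructor
  · rintro ⟨hS, hc⟩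
    exact ⟨hS, fun T hT hTs => hc ▸ hTs.card_le_alphaOn hT⟩
  · rintro ⟨hS, h⟩
    refine ⟨hS, le_antisymm (hS.card_le_alphaOn Finset.subset_union_left) ?_⟩
    obtain ⟨T, hT, hTs, hTc⟩ := exists_card_eq_alphaOn G (closedNbhd G S)
    exact hTc ▸ h T hT hTs

lemma empty_mem_Psi (G : SimpleGraph V) : ∅ ∈ Psi G := by
  refine mem_Psi_iff.2 ⟨fun x hx => by simp at hx, fun T hT _ => ?_⟩
  have : closedNbhd G ∅ = ∅ := by ext v; simp [mem_closedNbhd, mem_nbhd]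
  exact Finset.card_le_card (this ▸ hT)

lemma IsStable.mem_Psi_of_card_eq_alpha (hS : IsStable G S) (h : S.card = alpha G) :
    S ∈ Psi G :=
  mem_Psi_iff.2 ⟨hS, fun _ _ hT => h ▸ hT.card_le_alphaOn (Finset.subset_univ _)⟩

lemma IsStable.closedNbhd_eq_univ (hS : IsStable G S) (h : S.card = alpha G) :
    closedNbhd G S = Finset.univ := by
  refine Finset.eq_univ_iff_forall.2 fun x => ?_
  by_contra hx
  rw [mem_closedNbhd, not_or] at hx
  have := (hS.insert_vertex hx.2 hx.1).card_le_alphaOn (Finset.subset_univ _)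
  rw [Finset.card_insert_of_notMem hx.1, h] at this
  exact absurd this (by simp [alpha])

/-- Every local maximum stable set extends to a maximum stable set. -/
lemma exists_alpha_superset (hS : S ∈ Psi G) :
    ∃ T, S ⊆ T ∧ IsStable G T ∧ T.card = alpha G := by
  obtain ⟨hSs, hmax⟩ := mem_Psi_iff.1 hS
  obtain ⟨R, -, hR, hRc⟩ := exists_card_eq_alphaOn G Finset.univ
  have hst : IsStable G (S ∪ (R \ closedNbhd G S)) := by
    have key : ∀ a ∈ S, ∀ b, b ∈ R \ closedNbhd G S → ¬ G.Adj a b := fun a ha b hb hab =>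
      (Finset.mem_sdiff.1 hb).2 (mem_closedNbhd.2 (Or.inr (hSs.mem_nbhd_of_adj ha hab)))
    intro a ha b hb hab
    rcases Finset.mem_union.1 ha with ha | ha <;> rcases Finset.mem_union.1 hb with hb | hb
    · exact hSs ha hb hab
    · exact key a ha b hb hab
    · exact key b hb a ha hab.symm
    · exact hR (Finset.mem_sdiff.1 ha).1 (Finset.mem_sdiff.1 hb).1 hab
  refine ⟨_, Finset.subset_union_left, hst,
    le_antisymm (hst.card_le_alphaOn (Finset.subset_univ _)) ?_⟩
  have hdisj : Disjoint S (R \ closedNbhd G S) := by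
    rw [Finset.disjoint_left]
    exact fun a ha hb => (Finset.mem_sdiff.1 hb).2 (mem_closedNbhd.2 (Or.inl ha))
  have h1 := hmax (R ∩ closedNbhd G S) Finset.inter_subset_right
    (hR.mono Finset.inter_subset_left)
  have h2 := Finset.card_sdiff_add_card_inter R (closedNbhd G S)
  rw [Finset.card_union_of_disjoint hdisj, alpha, ← hRc]
  omega

/-- `f` matches `N(S)` into `S`. -/
def IsNbhdMatching (G : SimpleGraph V) (S : Finset V) (f : V → V) : Prop :=
  (∀ v ∈ nbhd G S, f v ∈ S ∧ G.Adj v (f v)) ∧ Set.InjOn f (nbhd G S)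

lemma IsNbhdMatching.card_nbhd_le (hf : IsNbhdMatching G S f) : (nbhd G S).card ≤ S.card :=
  Finset.card_le_card_of_injOn f (fun v hv => (hf.1 v hv).1) hf.2

lemma IsNbhdMatching.mem_Psi (hf : IsNbhdMatching G S f) (hS : IsStable G S) : S ∈ Psi G := by
  refine mem_Psi_iff.2 ⟨hS, fun T hT hTs => ?_⟩
  have hN : ∀ t ∈ T, t ∉ S → t ∈ nbhd G S := fun t ht hn =>
    (mem_closedNbhd.1 (hT ht)).resolve_left hn
  refine Finset.card_le_card_of_injOn (fun t => if t ∈ S then t else f t) (fun t ht => ?_) ?_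
  · by_cases h : t ∈ S
    · simp [h]
    · simpa [h] using (hf.1 t (hN t ht h)).1
  · intro a ha b hb hab
    by_cases h : a ∈ S <;> by_cases h' : b ∈ S <;> simp only [h, h', if_true, if_false] at hab
    · exact hab
    · exact absurd (hab ▸ (hf.1 b (hN b hb h')).2) (hTs hb ha)
    · exact absurd (hab ▸ (hf.1 a (hN a ha h)).2) (hTs ha hb)
    · exact hf.2 (hN a ha h) (hN b hb h') hab

/-- If `x` has at most one neighbor outside `N[S]`, a matching of `N(S)` into `S` extends
to a matching of `N(S ∪ {x})` into `S ∪ {x}`. -/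
lemma IsNbhdMatching.insert_vertex {x : V} (hf : IsNbhdMatching G S f) (hx : x ∉ S)
    (h1 : ∀ a b, G.Adj x a → G.Adj x b → a ∉ closedNbhd G S → b ∉ closedNbhd G S → a = b) :
    IsNbhdMatching G (insert x S) (fun v => if v ∈ nbhd G S then f v else x) := by
  have hnew : ∀ v ∈ nbhd G (insert x S), v ∉ nbhd G S →
      G.Adj x v ∧ v ∉ closedNbhd G S := by
    intro v hv hvn
    obtain ⟨hvS, u, hu, huv⟩ := mem_nbhd.1 hv
    rw [Finset.mem_insert, not_or] at hvS
    refine ⟨?_, fun h => (mem_closedNbhd.1 h).elim hvS.2 hvn⟩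
    rcases Finset.mem_insert.1 hu with rfl | hu
    · exact huv
    · exact absurd (mem_nbhd.2 ⟨hvS.2, u, hu, huv⟩) hvn
  constructor
  · intro v hv
    by_cases h : v ∈ nbhd G S
    · simpa [h] using ⟨Or.inr (hf.1 v h).1, (hf.1 v h).2⟩
    · simpa [h] using (hnew v hv h).1.symm
  · intro a ha b hb hab
    by_cases h : a ∈ nbhd G S <;> by_cases h' : b ∈ nbhd G S <;>
      simp only [h, h', if_true, if_false] at hab
    · exact hf.2 h h' hab
    · exact absurd (hab ▸ (hf.1 a h).1) hx
    · exact absurd (hab ▸ (hf.1 b h').1) hx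
    · exact h1 a b (hnew a ha h).1 (hnew b hb h').1 (hnew a ha h).2 (hnew b hb h').2

end StableSets

section Matchings

variable {G : SimpleGraph V} {S A : Finset V} {M M' : Finset (Sym2 V)} {f : V → V}

lemma IsGMatching.eq_of_mem (hM : IsGMatching G M) {e e' : Sym2 V} (he : e ∈ M) (he' : e' ∈ M)
    {v : V} (hv : v ∈ e) (hv' : v ∈ e') : e = e' := by
  by_contra h
  exact hM.2 e he e' he' h v hv hv'

lemma mem_msupp {v : V} : v ∈ msupp M ↔ MSaturates M v := by
  simp [msupp, MSaturates]

lemma IsGMatching.exists_transversal (hM : IsGMatching G M)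
    (h : ∀ e ∈ M, ∃ v ∈ A, v ∈ e) :
    ∃ c : Sym2 V → V, (∀ e ∈ M, c e ∈ A ∧ c e ∈ e) ∧ Set.InjOn c M := by
  have h' : ∀ e, ∃ v, e ∈ M → v ∈ A ∧ v ∈ e := fun e => by
    by_cases he : e ∈ M
    · obtain ⟨v, hv⟩ := h e he
      exact ⟨v, fun _ => hv⟩
    · exact ⟨e.out.1, fun h => absurd h he⟩
  choose c hc using h'
  exact ⟨c, hc, fun a ha b hb hab => hM.eq_of_mem ha hb (hc a ha).2 (hab ▸ (hc b hb).2)⟩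

lemma IsGMatching.card_le (hM : IsGMatching G M) (h : ∀ e ∈ M, ∃ v ∈ A, v ∈ e) :
    M.card ≤ A.card := by
  obtain ⟨c, hc, hinj⟩ := hM.exists_transversal h
  exact Finset.card_le_card_of_injOn c (fun e he => (hc e he).1) hinj

lemma bddAbove_matching_card (G : SimpleGraph V) (A : Finset V) :
    BddAbove {n | ∃ M, IsGMatchingOn G A M ∧ M.card = n} := by
  refine ⟨A.card, ?_⟩
  rintro n ⟨M, hM, rfl⟩
  exact hM.1.card_le fun e he => ⟨e.out.1, hM.2 e he _ e.out_fst_mem, e.out_fst_mem⟩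

lemma IsGMatchingOn.card_le_muOn (hM : IsGMatchingOn G A M) : M.card ≤ muOn G A :=
  le_csSup (bddAbove_matching_card G A) ⟨M, hM, rfl⟩

lemma exists_card_eq_muOn (G : SimpleGraph V) (A : Finset V) :
    ∃ M, IsGMatchingOn G A M ∧ M.card = muOn G A :=
  Nat.sSup_mem (s := {n | ∃ M, IsGMatchingOn G A M ∧ M.card = n})
    ⟨0, ∅, by simp [IsGMatchingOn, IsGMatching], rfl⟩ (bddAbove_matching_card G A)

/-- A stable set leaves every edge inside `N[S]` an endpoint in `N(S)`. -/
lemma IsGMatchingOn.exists_mem_nbhd (hS : IsStable G S) (hM : IsGMatchingOn G (closedNbhd G S) M) :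
    ∀ e ∈ M, ∃ v ∈ nbhd G S, v ∈ e := by
  intro e he
  induction e using Sym2.ind with
  | _ a b =>
    have hab : G.Adj a b := hM.1.1 _ he
    rcases mem_closedNbhd.1 (hM.2 _ he a (by simp)) with ha | ha
    · exact ⟨b, hS.mem_nbhd_of_adj ha hab, by simp⟩
    · exact ⟨a, ha, by simp⟩

/-- A matching of `N[S]` with at least `|N(S)|` edges matches `N(S)` into `S`. -/
lemma IsGMatchingOn.exists_isNbhdMatching (hS : IsStable G S)
    (hM : IsGMatchingOn G (closedNbhd G S) M) (hc : (nbhd G S).card ≤ M.card) :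
    ∃ p, IsNbhdMatching G S p ∧ (∀ v ∈ nbhd G S, s(v, p v) ∈ M) ∧
      ∀ e ∈ M, ∃ v ∈ nbhd G S, e = s(v, p v) := by
  obtain ⟨c, hcm, hinj⟩ := hM.1.exists_transversal (hM.exists_mem_nbhd hS)
  have hsurj : ∀ v ∈ nbhd G S, ∃ e ∈ M, c e = v := fun v hv => by
    obtain ⟨e, he, h⟩ := Finset.surj_on_of_inj_on_of_card_le (s := M) (t := nbhd G S)
      (fun e _ => c e) (fun e he => (hcm e he).1) (fun a b ha hb hab => hinj ha hb hab) hc v hv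
    exact ⟨e, he, h.symm⟩
  have hp : ∀ v, ∃ w, v ∈ nbhd G S → s(v, w) ∈ M ∧ c s(v, w) = v := fun v => by
    by_cases hv : v ∈ nbhd G S
    · obtain ⟨e, he, hev⟩ := hsurj v hv
      have hve : v ∈ e := hev ▸ (hcm e he).2
      obtain ⟨w, rfl⟩ := Sym2.mem_iff_exists.1 hve
      exact ⟨w, fun _ => ⟨he, hev⟩⟩
    · exact ⟨v, fun h => absurd h hv⟩
  choose p hp using hp
  have hadj : ∀ v ∈ nbhd G S, G.Adj v (p v) := fun v hv => hM.1.1 _ (hp v hv).1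
  refine ⟨p, ⟨fun v hv => ⟨?_, hadj v hv⟩, fun a ha b hb hab => ?_⟩, fun v hv => (hp v hv).1,
    fun e he => ⟨c e, (hcm e he).1, ?_⟩⟩
  · refine (mem_closedNbhd.1 (hM.2 _ (hp v hv).1 (p v) (by simp))).resolve_right fun hpv => ?_
    obtain ⟨e, he, hev⟩ := hsurj _ hpv
    have := hM.1.eq_of_mem he (hp v hv).1 (hev ▸ (hcm e he).2) (v := p v) (by simp)
    rw [this, (hp v hv).2] at hev
    exact (hadj v hv).ne hev
  · have := hM.1.eq_of_mem (hp a ha).1 (hp b hb).1 (v := p a) (by simp) (by simp [hab])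
    rw [← (hp a ha).2, this, (hp b hb).2]
  · exact hM.1.eq_of_mem he (hp _ (hcm e he).1).1 (hcm e he).2 (by simp)

/-- The set of edges joining each vertex of `N(S)` to its image under `f`. -/
noncomputable def nbhdEdges (G : SimpleGraph V) (S : Finset V) (f : V → V) : Finset (Sym2 V) :=
  (nbhd G S).image fun v => s(v, f v)

lemma mem_nbhdEdges {e : Sym2 V} : e ∈ nbhdEdges G S f ↔ ∃ v ∈ nbhd G S, s(v, f v) = e := by
  simp [nbhdEdges]

lemma IsNbhdMatching.eq_of_mem_edge (hf : IsNbhdMatching G S f) {a b x : V}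
    (ha : a ∈ nbhd G S) (hb : b ∈ nbhd G S) (hxa : x ∈ s(a, f a)) (hxb : x ∈ s(b, f b)) :
    a = b := by
  rcases Sym2.mem_iff.1 hxa with rfl | rfl <;> rcases Sym2.mem_iff.1 hxb with h | h
  · exact h
  · exact absurd (h ▸ (hf.1 b hb).1) (mem_nbhd.1 ha).1
  · exact absurd (h ▸ (hf.1 a ha).1) (mem_nbhd.1 hb).1
  · exact hf.2 ha hb h

lemma IsNbhdMatching.isGMatchingOn (hf : IsNbhdMatching G S f) :
    IsGMatchingOn G (closedNbhd G S) (nbhdEdges G S f) := by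
  refine ⟨⟨fun e he => ?_, fun e he e' he' hne x hx hx' => ?_⟩, fun e he x hx => ?_⟩
  · obtain ⟨v, hv, rfl⟩ := mem_nbhdEdges.1 he
    exact (hf.1 v hv).2
  · obtain ⟨a, ha, rfl⟩ := mem_nbhdEdges.1 he
    obtain ⟨b, hb, rfl⟩ := mem_nbhdEdges.1 he'
    exact hne (by rw [hf.eq_of_mem_edge ha hb hx hx'])
  · obtain ⟨v, hv, rfl⟩ := mem_nbhdEdges.1 he
    rcases Sym2.mem_iff.1 hx with rfl | rfl
    · exact mem_closedNbhd.2 (Or.inr hv)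
    · exact mem_closedNbhd.2 (Or.inl (hf.1 v hv).1)

lemma IsNbhdMatching.card_nbhdEdges (hf : IsNbhdMatching G S f) :
    (nbhdEdges G S f).card = (nbhd G S).card :=
  Finset.card_image_of_injOn fun a ha b hb (hab : s(a, f a) = s(b, f b)) =>
    hf.eq_of_mem_edge ha hb (x := a) (by simp) (hab ▸ by simp)

lemma IsNbhdMatching.muOn_eq (hf : IsNbhdMatching G S f) (hS : IsStable G S) :
    muOn G (closedNbhd G S) = (nbhd G S).card := by
  apply le_antisymm
  · obtain ⟨M, hM, hMc⟩ := exists_card_eq_muOn G (closedNbhd G S)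
    exact hMc ▸ hM.1.card_le (hM.exists_mem_nbhd hS)
  · exact hf.card_nbhdEdges ▸ hf.isGMatchingOn.card_le_muOn

lemma card_closedNbhd (G : SimpleGraph V) (S : Finset V) :
    (closedNbhd G S).card = S.card + (nbhd G S).card :=
  Finset.card_union_of_disjoint
    (Finset.disjoint_left.2 fun _ ha hb => (mem_nbhd.1 hb).1 ha)

lemma IsNbhdMatching.konigEgervaryOn (hf : IsNbhdMatching G S f) (hS : IsStable G S) :
    KonigEgervaryOn G (closedNbhd G S) := by
  rw [KonigEgervaryOn, hf.muOn_eq hS, card_closedNbhd, (hf.mem_Psi hS).2]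

lemma KonigEgervaryOn.exists_isNbhdMatching (h : KonigEgervaryOn G (closedNbhd G S))
    (hS : S ∈ Psi G) : ∃ f, IsNbhdMatching G S f := by
  rw [KonigEgervaryOn, card_closedNbhd, ← hS.2, add_right_inj] at h
  obtain ⟨M, hM, hMc⟩ := exists_card_eq_muOn G (closedNbhd G S)
  obtain ⟨p, hp, -⟩ := hM.exists_isNbhdMatching hS.1 (hMc ▸ h.ge)
  exact ⟨p, hp⟩

end Matchings

section Accessible

variable {G : SimpleGraph V} {S T : Finset V} {M M' : Finset (Sym2 V)}

lemma not_adj_of_no_cycle_three (h3 : ∀ (v : V) (c : G.Walk v v), c.IsCycle → c.length ≠ 3)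
    {a b c : V} (hab : G.Adj a b) (hac : G.Adj a c) : ¬ G.Adj b c := fun hbc => by
  obtain ⟨u, w, hw, hl⟩ := SimpleGraph.is3Clique_iff_exists_cycle_length_three.1
    ⟨{a, b, c}, SimpleGraph.is3Clique_triple_iff.2 ⟨hab, hac, hbc⟩⟩
  exact h3 u w hw hl

/-- In a triangle-free graph, if `T` and `T - x` are local maximum stable sets, then `x` has at
most one neighbor outside `N[T - x]`. -/
lemma eq_of_adj_of_erase_mem_Psi
    (h3 : ∀ (v : V) (c : G.Walk v v), c.IsCycle → c.length ≠ 3) {x : V} (hx : x ∈ T)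
    (hT : T ∈ Psi G) (hT' : T.erase x ∈ Psi G) {a b : V} (ha : G.Adj x a) (hb : G.Adj x b)
    (ha' : a ∉ closedNbhd G (T.erase x)) (hb' : b ∉ closedNbhd G (T.erase x)) : a = b := by
  by_contra hne
  simp only [mem_closedNbhd, not_or] at ha' hb'
  have hst : IsStable G (insert a (insert b (T.erase x))) := by
    have h1 := hT'.1.insert_vertex hb'.2 hb'.1
    refine h1.insert_vertex (fun h => ?_) (by simp [hne, ha'.1])
    obtain ⟨-, u, hu, hua⟩ := mem_nbhd.1 h
    rcases Finset.mem_insert.1 hu with rfl | hu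
    · exact not_adj_of_no_cycle_three h3 hb ha hua
    · exact ha'.2 (hT'.1.mem_nbhd_of_adj hu hua)
  have hle := (mem_Psi_iff.1 hT).2 _ (fun y hy => ?_) hst
  · rw [Finset.card_insert_of_notMem (by simp [hne, ha'.1]),
      Finset.card_insert_of_notMem hb'.1, Finset.card_erase_of_mem hx] at hle
    omega
  · rw [mem_closedNbhd]
    rcases Finset.mem_insert.1 hy with rfl | hy
    · exact Or.inr (hT.1.mem_nbhd_of_adj hx ha)
    rcases Finset.mem_insert.1 hy with rfl | hy
    · exact Or.inr (hT.1.mem_nbhd_of_adj hx hb)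
    · exact Or.inl (Finset.mem_of_mem_erase hy)

lemma AccessibleFam.induction {F : Set (Finset V)} (hF : AccessibleFam F)
    {P : Finset V → Prop} (h0 : P ∅)
    (h : ∀ T ∈ F, ∀ x ∈ T, T.erase x ∈ F → P (T.erase x) → P T) {T : Finset V} (hT : T ∈ F) :
    P T := by
  induction hn : T.card generalizing T with
  | zero => rwa [Finset.card_eq_zero.1 hn]
  | succ n ih =>
    obtain ⟨x, hx, hxF⟩ := hF T hT (by rintro rfl; simp at hn)
    exact h T hT x hx hxF (ih hxF (by rw [Finset.card_erase_of_mem hx, hn]; rfl))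

lemma AccessibleFam.exists_isNbhdMatching
    (h3 : ∀ (v : V) (c : G.Walk v v), c.IsCycle → c.length ≠ 3) (hF : AccessibleFam (Psi G))
    (hT : T ∈ Psi G) : ∃ f, IsNbhdMatching G T f := by
  refine hF.induction (P := fun T => ∃ f, IsNbhdMatching G T f) ?_ ?_ hT
  · exact ⟨id, by constructor <;> simp [nbhd]⟩
  · rintro T hT x hx hT' ⟨f, hf⟩
    have := hf.insert_vertex (Finset.notMem_erase x T) fun a b ha hb ha' hb' =>
      eq_of_adj_of_erase_mem_Psi h3 hx hT hT' ha hb ha' hb'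
    rw [Finset.insert_erase hx] at this
    exact ⟨_, this⟩

/-- A matching saturating a stable set `T` with `|N(T)| ≤ |T|` matches `T` onto `N(T)`. -/
lemma IsGMatching.exists_edge_of_mem_nbhd (hM : IsGMatching G M) (hT : IsStable G T)
    (hc : (nbhd G T).card ≤ T.card) (hsat : ∀ v ∈ T, MSaturates M v) {y : V}
    (hy : y ∈ nbhd G T) : ∃ x ∈ T, s(x, y) ∈ M := by
  have h : ∀ x, ∃ w, x ∈ T → s(x, w) ∈ M := fun x => by
    by_cases hx : x ∈ T
    · obtain ⟨e, he, hxe⟩ := hsat x hx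
      obtain ⟨w, rfl⟩ := Sym2.mem_iff_exists.1 hxe
      exact ⟨w, fun _ => he⟩
    · exact ⟨x, fun h => absurd h hx⟩
  choose p hp using h
  have hadj : ∀ x ∈ T, G.Adj x (p x) := fun x hx => hM.1 _ (hp x hx)
  obtain ⟨x, hx, hxy⟩ := Finset.surj_on_of_inj_on_of_card_le (s := T) (t := nbhd G T)
    (fun x _ => p x) (fun x hx => hT.mem_nbhd_of_adj hx (hadj x hx)) (fun a b ha hb hab => by
      have := hM.eq_of_mem (hp a ha) (hp b hb) (v := p a) (by simp) (by simp [hab])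
      rcases Sym2.mem_iff.1 (this ▸ Sym2.mem_mk_left a (p a) : a ∈ s(b, p b)) with h | h
      · exact h
      · exact absurd (h ▸ hadj b hb) (hT hb ha)) hc y hy
  exact ⟨x, hx, hxy ▸ hp x hx⟩

/-- Two matchings saturating a local maximum stable set agree on it. -/
lemma AccessibleFam.mem_of_mem_of_saturates
    (h3 : ∀ (v : V) (c : G.Walk v v), c.IsCycle → c.length ≠ 3) (hF : AccessibleFam (Psi G))
    (hT : T ∈ Psi G) (hM : IsGMatching G M) (hM' : IsGMatching G M')
    (hsat : ∀ v ∈ T, MSaturates M v) (hsat' : ∀ v ∈ T, MSaturates M' v) {x : V} (hx : x ∈ T)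
    {e : Sym2 V} (he : e ∈ M) (hxe : x ∈ e) : e ∈ M' := by
  suffices H : (∀ v ∈ T, MSaturates M v) → (∀ v ∈ T, MSaturates M' v) →
      ∀ x ∈ T, ∀ e ∈ M, x ∈ e → e ∈ M' from H hsat hsat' x hx e he hxe
  refine hF.induction (P := fun T => (∀ v ∈ T, MSaturates M v) → (∀ v ∈ T, MSaturates M' v) →
      ∀ x ∈ T, ∀ e ∈ M, x ∈ e → e ∈ M') (by simp) ?_ hT
  intro T hT z hz hT' ih hs hs' x hx e he hxe
  have hs₁ : ∀ v ∈ T.erase z, MSaturates M v := fun v hv => hs v (Finset.mem_of_mem_erase hv)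
  have hs₂ : ∀ v ∈ T.erase z, MSaturates M' v := fun v hv => hs' v (Finset.mem_of_mem_erase hv)
  by_cases hxz : x = z
  swap
  · exact ih hs₁ hs₂ x (Finset.mem_erase.2 ⟨hxz, hx⟩) e he hxe
  subst hxz
  obtain ⟨f, hf⟩ := hF.exists_isNbhdMatching h3 hT'
  have new : ∀ {N : Finset (Sym2 V)}, IsGMatching G N →
      (∀ v ∈ T.erase x, MSaturates N v) → ∀ y, s(x, y) ∈ N →
      y ∉ closedNbhd G (T.erase x) := by
    intro N hN hsN y hy hmem
    have hxy : G.Adj x y := hN.1 _ hy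
    rcases mem_closedNbhd.1 hmem with h | h
    · exact hT.1 hx (Finset.mem_of_mem_erase h) hxy
    · obtain ⟨u, hu, huy⟩ := hN.exists_edge_of_mem_nbhd hT'.1 hf.card_nbhd_le hsN h
      have := hN.eq_of_mem huy hy (v := y) (by simp) (by simp)
      rcases Sym2.mem_iff.1 (this ▸ Sym2.mem_mk_left u y : u ∈ s(x, y)) with h' | h'
      · exact Finset.ne_of_mem_erase hu h'
      · exact (hN.1 _ huy : G.Adj u y).ne h'
  obtain ⟨a, rfl⟩ := Sym2.mem_iff_exists.1 hxe
  obtain ⟨e', he', hxe'⟩ := hs' x hx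
  obtain ⟨b, rfl⟩ := Sym2.mem_iff_exists.1 hxe'
  obtain rfl : a = b := eq_of_adj_of_erase_mem_Psi h3 hx hT hT' (hM.1 _ he) (hM'.1 _ he')
    (new hM hs₁ a he) (new hM' hs₂ b he')
  exact he'

lemma AccessibleFam.uniquelyRestricted
    (h3 : ∀ (v : V) (c : G.Walk v v), c.IsCycle → c.length ≠ 3) (hF : AccessibleFam (Psi G))
    (hM : IsMaximumGMatching G M) : UniquelyRestricted G M := by
  refine ⟨hM.1, fun M' hM' hsat => ?_⟩
  obtain ⟨S, -, hS, hSc⟩ := exists_card_eq_alphaOn G Finset.univ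
  have huniv := hS.closedNbhd_eq_univ hSc
  obtain ⟨f, hf⟩ := hF.exists_isNbhdMatching h3 (hS.mem_Psi_of_card_eq_alpha hSc)
  have hmu := hf.muOn_eq hS
  rw [huniv] at hmu
  have hMon : IsGMatchingOn G (closedNbhd G S) M := ⟨hM.1, by simp [huniv]⟩
  obtain ⟨p, hp, hpM, hMp⟩ := hMon.exists_isNbhdMatching hS (by rw [hM.2, mu, hmu])
  have hR : IsStable G (S ∩ msupp M) := hS.mono Finset.inter_subset_left
  have hpR : IsNbhdMatching G (S ∩ msupp M) p := by
    have hsub : nbhd G (S ∩ msupp M) ⊆ nbhd G S := fun v hv => by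
      obtain ⟨-, u, hu, huv⟩ := mem_nbhd.1 hv
      exact hS.mem_nbhd_of_adj (Finset.mem_inter.1 hu).1 huv
    refine ⟨fun v hv => ?_, hp.2.mono (by exact_mod_cast hsub)⟩
    obtain ⟨h1, h2⟩ := hp.1 v (hsub hv)
    exact ⟨Finset.mem_inter.2 ⟨h1, mem_msupp.2 ⟨_, hpM v (hsub hv), by simp⟩⟩, h2⟩
  have hsub : ∀ e ∈ M, e ∈ M' := fun e he => by
    obtain ⟨v, hv, rfl⟩ := hMp e he
    exact hF.mem_of_mem_of_saturates h3 (hpR.mem_Psi hR) hM.1 hM'.1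
      (fun v hv => mem_msupp.1 (Finset.mem_inter.1 hv).2)
      (fun v hv => hsat v (Finset.mem_inter.1 hv).2)
      (Finset.mem_inter.2 ⟨(hp.1 v hv).1, mem_msupp.2 ⟨_, he, by simp⟩⟩) he (by simp)
  refine Finset.Subset.antisymm (fun e he => ?_) hsub
  have hv := e.out_fst_mem
  obtain ⟨e', he', hve'⟩ := mem_msupp.1 (hM'.2 e he _ hv)
  rwa [hM'.1.eq_of_mem he (hsub e' he') hv hve']

end Accessible

section UniquelyRestricted

variable {G : SimpleGraph V} {S T : Finset V} {f g : V → V}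

lemma IsNbhdMatching.eqOn_of_uniquelyRestricted
    (hg : IsNbhdMatching G S g) (hU : UniquelyRestricted G (nbhdEdges G S f))
    (himg : (nbhd G S).image g = (nbhd G S).image f) : ∀ v ∈ nbhd G S, g v = f v := by
  have hEq : nbhdEdges G S g = nbhdEdges G S f := by
    refine hU.2 _ ⟨hg.isGMatchingOn.1, fun e he v hv => ?_⟩ fun v hv => ?_
    · obtain ⟨a, ha, rfl⟩ := mem_nbhdEdges.1 he
      rw [mem_msupp]
      rcases Sym2.mem_iff.1 hv with rfl | rfl
      · exact ⟨_, mem_nbhdEdges.2 ⟨v, ha, rfl⟩, by simp⟩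
      · obtain ⟨b, hb, hba⟩ := Finset.mem_image.1 (himg ▸ Finset.mem_image_of_mem g ha)
        exact ⟨_, mem_nbhdEdges.2 ⟨b, hb, rfl⟩, by simp [hba]⟩
    · obtain ⟨e, he, hve⟩ := mem_msupp.1 hv
      obtain ⟨a, ha, rfl⟩ := mem_nbhdEdges.1 he
      rcases Sym2.mem_iff.1 hve with rfl | rfl
      · exact ⟨_, mem_nbhdEdges.2 ⟨v, ha, rfl⟩, by simp⟩
      · obtain ⟨b, hb, hba⟩ := Finset.mem_image.1 (himg.symm ▸ Finset.mem_image_of_mem f ha)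
        exact ⟨_, mem_nbhdEdges.2 ⟨b, hb, rfl⟩, by simp [hba]⟩
  intro v hv
  obtain ⟨a, ha, hav⟩ := mem_nbhdEdges.1 (hEq ▸ mem_nbhdEdges.2 ⟨v, hv, rfl⟩ :
    s(v, g v) ∈ nbhdEdges G S f)
  rcases Sym2.eq_iff.1 hav with ⟨rfl, h⟩ | ⟨h, -⟩
  · exact h.symm
  · exact absurd (h ▸ (hg.1 v hv).1) (mem_nbhd.1 ha).1

/-- Overriding a matching of `N(T)` into `T` on `N(S)`, for `S ⊆ T`. -/
lemma IsNbhdMatching.piecewise (hT : IsStable G T) (hST : S ⊆ T) (hf : IsNbhdMatching G S f)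
    (hg : IsNbhdMatching G T g) :
    IsNbhdMatching G T (fun v => if v ∈ nbhd G S then f v else g v) := by
  have hS := hT.mono hST
  have hout : ∀ v ∈ nbhd G T, v ∉ nbhd G S → g v ∉ S := fun v hv hvS h =>
    hvS (hS.mem_nbhd_of_adj h (hg.1 v hv).2.symm)
  constructor
  · intro v hv
    by_cases h : v ∈ nbhd G S
    · simpa [h] using ⟨hST (hf.1 v h).1, (hf.1 v h).2⟩
    · simpa [h] using hg.1 v hv
  · intro a ha b hb hab
    by_cases h : a ∈ nbhd G S <;> by_cases h' : b ∈ nbhd G S <;>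
      simp only [h, h', if_true, if_false] at hab
    · exact hf.2 h h' hab
    · exact absurd (hab ▸ (hf.1 a h).1) (hout b hb h')
    · exact absurd (hab ▸ (hf.1 b h').1) (hout a ha h)
    · exact hg.2 ha hb hab

/-- If all maximum matchings are uniquely restricted and `G` is König-Egerváry, then two matchings
of `N(S)` onto the same subset of `S` coincide. -/
lemma IsNbhdMatching.eqOn_of_image_eq (hT : IsStable G T) (hTc : T.card = alpha G)
    (hTg : ∃ g, IsNbhdMatching G T g) (hST : S ⊆ T)
    (hU : ∀ M : Finset (Sym2 V), IsMaximumGMatching G M → UniquelyRestricted G M)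
    (hf : IsNbhdMatching G S f) (hg : IsNbhdMatching G S g)
    (himg : (nbhd G S).image g = (nbhd G S).image f) : ∀ v ∈ nbhd G S, g v = f v := by
  obtain ⟨k, hk⟩ := hTg
  have hf' := hf.piecewise hT hST hk
  have hg' := hg.piecewise hT hST hk
  have hmax : IsMaximumGMatching G
      (nbhdEdges G T (fun v => if v ∈ nbhd G S then f v else k v)) := by
    refine ⟨hf'.isGMatchingOn.1, ?_⟩
    rw [hf'.card_nbhdEdges, mu, ← hT.closedNbhd_eq_univ hTc, hf'.muOn_eq hT]
  have hsub : nbhd G S ⊆ nbhd G T := fun v hv => by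
    obtain ⟨-, u, hu, huv⟩ := mem_nbhd.1 hv
    exact hT.mem_nbhd_of_adj (hST hu) huv
  have himg_le : ∀ {f g : V → V}, (nbhd G S).image g = (nbhd G S).image f →
      (nbhd G T).image (fun v => if v ∈ nbhd G S then g v else k v) ⊆
        (nbhd G T).image (fun v => if v ∈ nbhd G S then f v else k v) := by
    intro f g h x hx
    obtain ⟨v, hv, rfl⟩ := Finset.mem_image.1 hx
    by_cases hvS : v ∈ nbhd G S
    · obtain ⟨w, hw, hwv⟩ := Finset.mem_image.1 (h ▸ Finset.mem_image_of_mem g hvS)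
      exact Finset.mem_image.2 ⟨w, hsub hw, by simp [hw, hvS, hwv]⟩
    · exact Finset.mem_image.2 ⟨v, hv, by simp [hvS]⟩
  intro v hv
  simpa [hv] using hg'.eqOn_of_uniquelyRestricted (hU _ hmax)
    (Finset.Subset.antisymm (himg_le himg) (himg_le himg.symm)) v (hsub hv)

/-- A self-map of a nonempty finite set permutes some nonempty subset. -/
lemma exists_nonempty_image_eq {α : Type*} [DecidableEq α] {A : Finset α} (hA : A.Nonempty)
    {σ : α → α} (hσ : ∀ a ∈ A, σ a ∈ A) : ∃ C ⊆ A, C.Nonempty ∧ C.image σ = C := by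
  obtain ⟨C, hC, hmin⟩ := Finset.exists_min_image
    (A.powerset.filter fun C => C.Nonempty ∧ C.image σ ⊆ C) Finset.card
    ⟨A, by simpa [hA, Finset.image_subset_iff] using hσ⟩
  simp only [Finset.mem_filter, Finset.mem_powerset] at hC hmin
  refine ⟨C, hC.1, hC.2.1, Finset.eq_of_subset_of_card_le hC.2.2 (hmin _ ⟨?_, ?_, ?_⟩)⟩
  · exact hC.2.2.trans hC.1
  · exact hC.2.1.image σ
  · exact Finset.image_subset_image hC.2.2

/-- If the matching `f` of `N(S)` onto `S` is the only one, some vertex of `N(S)` has its partner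
as unique neighbor in `S`. -/
lemma IsNbhdMatching.exists_unique_neighbor (hne : (nbhd G S).Nonempty)
    (hf : IsNbhdMatching G S f) (hsurj : ∀ x ∈ S, ∃ v ∈ nbhd G S, f v = x)
    (huniq : ∀ g, IsNbhdMatching G S g → (nbhd G S).image g = (nbhd G S).image f →
      ∀ v ∈ nbhd G S, g v = f v) :
    ∃ y ∈ nbhd G S, ∀ x ∈ S, G.Adj y x → x = f y := by
  by_contra hcon
  push Not at hcon
  have hσ : ∀ y, ∃ z, y ∈ nbhd G S → z ∈ nbhd G S ∧ G.Adj y (f z) ∧ f z ≠ f y := fun y => by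
    by_cases hy : y ∈ nbhd G S
    · obtain ⟨x, hx, hyx, hxne⟩ := hcon y hy
      obtain ⟨z, hz, rfl⟩ := hsurj x hx
      exact ⟨z, fun _ => ⟨hz, hyx, hxne⟩⟩
    · exact ⟨y, fun h => absurd h hy⟩
  choose σ hσ using hσ
  obtain ⟨C, hCN, ⟨c, hc⟩, hCσ⟩ := exists_nonempty_image_eq hne fun a ha => (hσ a ha).1
  have hσC : ∀ a ∈ C, σ a ∈ C := fun a ha => hCσ ▸ Finset.mem_image_of_mem σ ha
  have hinj : Set.InjOn σ C := Finset.card_image_iff.1 (by rw [hCσ])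
  have hmem : ∀ v ∈ nbhd G S, (if v ∈ C then σ v else v) ∈ nbhd G S := fun v hv => by
    split_ifs with h
    · exact hCN (hσC v h)
    · exact hv
  have hg : IsNbhdMatching G S (fun v => f (if v ∈ C then σ v else v)) := by
    constructor
    · intro v hv
      refine ⟨(hf.1 _ (hmem v hv)).1, ?_⟩
      by_cases h : v ∈ C
      · simpa [h] using (hσ v hv).2.1
      · simpa [h] using (hf.1 v hv).2
    · intro a ha b hb hab
      have hab' := hf.2 (hmem a ha) (hmem b hb) hab
      by_cases h : a ∈ C <;> by_cases h' : b ∈ C <;>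
        simp only [h, h', if_true, if_false] at hab'
      · exact hinj h h' hab'
      · exact absurd (hab' ▸ hσC a h) h'
      · exact absurd (hab' ▸ hσC b h') h
      · exact hab'
  have himg : (nbhd G S).image (fun v => f (if v ∈ C then σ v else v)) =
      (nbhd G S).image f := by
    refine Finset.eq_of_subset_of_card_le (fun x hx => ?_) ?_
    · obtain ⟨v, hv, rfl⟩ := Finset.mem_image.1 hx
      exact Finset.mem_image_of_mem f (hmem v hv)
    · rw [Finset.card_image_of_injOn hg.2, Finset.card_image_of_injOn hf.2]
  have := huniq _ hg himg c (hCN hc)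
  simp only [hc, if_true] at this
  exact (hσ c (hCN hc)).2.2 this

lemma accessibleFam_Psi
    (hU : ∀ M : Finset (Sym2 V), IsMaximumGMatching G M → UniquelyRestricted G M)
    (hK : ∀ S ∈ Psi G, ∃ f, IsNbhdMatching G S f) : AccessibleFam (Psi G) := by
  intro S hS hne
  obtain ⟨T, hST, hT, hTc⟩ := exists_alpha_superset hS
  obtain ⟨f, hf⟩ := hK S hS
  have hsub : ∀ x, nbhd G (S.erase x) ⊆ nbhd G S := fun x v hv => by
    obtain ⟨-, u, hu, huv⟩ := mem_nbhd.1 hv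
    exact hS.1.mem_nbhd_of_adj (Finset.mem_of_mem_erase hu) huv
  suffices H : ∃ x ∈ S, ∀ v ∈ nbhd G (S.erase x), f v ≠ x by
    obtain ⟨x, hx, hfx⟩ := H
    refine ⟨x, hx, IsNbhdMatching.mem_Psi (f := f) ⟨fun v hv => ?_, ?_⟩
      (hS.1.mono (Finset.erase_subset _ _))⟩
    · obtain ⟨h1, h2⟩ := hf.1 v (hsub x hv)
      exact ⟨Finset.mem_erase.2 ⟨hfx v hv, h1⟩, h2⟩
    · exact hf.2.mono (by exact_mod_cast hsub x)
  by_cases hsurj : ∀ x ∈ S, ∃ v ∈ nbhd G S, f v = x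
  · obtain ⟨x₀, hx₀⟩ := Finset.nonempty_iff_ne_empty.2 hne
    obtain ⟨v₀, hv₀, -⟩ := hsurj x₀ hx₀
    obtain ⟨y, hy, huy⟩ := hf.exists_unique_neighbor ⟨v₀, hv₀⟩ hsurj fun g hg himg =>
      hf.eqOn_of_image_eq hT hTc (hK T (hT.mem_Psi_of_card_eq_alpha hTc)) hST hU hg himg
    refine ⟨f y, (hf.1 y hy).1, fun v hv hvy => ?_⟩
    obtain rfl := hf.2 (hsub _ hv) hy hvy
    obtain ⟨-, u, hu, huv⟩ := mem_nbhd.1 hv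
    exact Finset.ne_of_mem_erase hu (huy u (Finset.mem_of_mem_erase hu) huv.symm)
  · push Not at hsurj
    obtain ⟨x, hx, h⟩ := hsurj
    exact ⟨x, hx, fun v hv => h v (hsub x hv)⟩

end UniquelyRestricted

section Exchange

variable {G : SimpleGraph V}

/-- If `Y` and `Z` are stable with matched neighborhoods and `Z - z` is contained in `N[Y]`,
then `z` has at most one neighbor outside `N[Y]`. -/
lemma IsNbhdMatching.eq_of_adj_of_erase_subset {Y Z : Finset V} {f g : V → V}
    (hY : IsStable G Y) (hZ : IsStable G Z) (hf : IsNbhdMatching G Y f)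
    (hg : IsNbhdMatching G Z g) {z : V} (hz : z ∈ Z)
    (hsub : Z.erase z ⊆ closedNbhd G Y) {a b : V} (ha : G.Adj z a) (hb : G.Adj z b)
    (ha' : a ∉ closedNbhd G Y) (hb' : b ∉ closedNbhd G Y) : a = b := by
  by_contra hne
  set A := Z.erase z \ Y with hA
  have hAN : ∀ v ∈ A, v ∈ nbhd G Y := fun v hv =>
    (mem_closedNbhd.1 (hsub (Finset.mem_sdiff.1 hv).1)).resolve_left (Finset.mem_sdiff.1 hv).2
  have hAZ : ∀ v ∈ A, v ∈ Z := fun v hv =>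
    Finset.mem_of_mem_erase (Finset.mem_sdiff.1 hv).1
  have hfY : ∀ x ∈ A.image f, x ∈ Y := fun x hx => by
    obtain ⟨v, hv, rfl⟩ := Finset.mem_image.1 hx
    exact (hf.1 v (hAN v hv)).1
  set W := insert a (insert b (A.image f)) with hW
  have hbim : b ∉ A.image f := fun h => hb' (mem_closedNbhd.2 (Or.inl (hfY b h)))
  have haim : a ∉ insert b (A.image f) := fun h => by
    rcases Finset.mem_insert.1 h with h | h
    · exact hne h
    · exact ha' (mem_closedNbhd.2 (Or.inl (hfY a h)))
  have hWc : W.card = A.card + 2 := by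
    rw [hW, Finset.card_insert_of_notMem haim, Finset.card_insert_of_notMem hbim,
      Finset.card_image_of_injOn (hf.2.mono fun v hv => hAN v hv)]
  have hWZ : ∀ w ∈ W, w ∈ nbhd G Z := fun w hw => by
    simp only [hW, Finset.mem_insert, Finset.mem_image] at hw
    rcases hw with rfl | rfl | ⟨v, hv, rfl⟩
    · exact hZ.mem_nbhd_of_adj hz ha
    · exact hZ.mem_nbhd_of_adj hz hb
    · exact hZ.mem_nbhd_of_adj (hAZ v hv) (hf.1 v (hAN v hv)).2
  have hWY : ∀ w ∈ W, ∀ y ∈ Y, ¬ G.Adj w y := fun w hw y hy hwy => by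
    rcases Finset.mem_insert.1 hw with rfl | hw
    · exact ha' (mem_closedNbhd.2 (Or.inr (hY.mem_nbhd_of_adj hy hwy.symm)))
    rcases Finset.mem_insert.1 hw with rfl | hw
    · exact hb' (mem_closedNbhd.2 (Or.inr (hY.mem_nbhd_of_adj hy hwy.symm)))
    · exact hY (hfY w hw) hy hwy
  have hle : W.card ≤ (insert z A).card := by
    refine Finset.card_le_card_of_injOn g (fun w hw => ?_) (hg.2.mono fun w hw => hWZ w hw)
    obtain ⟨h1, h2⟩ := hg.1 w (hWZ w hw)
    have h3 : g w ∉ Y := fun h => hWY w hw _ h h2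
    by_cases h : g w = z <;> simp [hA, h, h1, h3]
  have := Finset.card_insert_le z A
  omega

lemma exchangeFam_Psi (hacc : AccessibleFam (Psi G))
    (hK : ∀ S ∈ Psi G, ∃ f, IsNbhdMatching G S f) : ExchangeFam (Psi G) := by
  intro X hX Y hY hcard
  have hXY : ¬ X ⊆ closedNbhd G Y := fun h => by
    have := (mem_Psi_iff.1 hY).2 X h hX.1
    omega
  have hex : ∃ Z ∈ Psi G, Z ⊆ X ∧ ∃ z ∈ Z, z ∉ closedNbhd G Y ∧
      Z.erase z ⊆ closedNbhd G Y := by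
    revert hXY
    refine hacc.induction (P := fun X => ¬ X ⊆ closedNbhd G Y → ∃ Z ∈ Psi G, Z ⊆ X ∧ ∃ z ∈ Z,
      z ∉ closedNbhd G Y ∧ Z.erase z ⊆ closedNbhd G Y) (by simp) ?_ hX
    intro T hT x hx hT' ih hTY
    by_cases h : T.erase x ⊆ closedNbhd G Y
    · refine ⟨T, hT, subset_rfl, x, hx, fun hxY => hTY ?_, h⟩
      rw [← Finset.insert_erase hx]
      exact Finset.insert_subset hxY h
    · obtain ⟨Z, hZ, hZT, hz⟩ := ih h
      exact ⟨Z, hZ, hZT.trans (Finset.erase_subset _ _), hz⟩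
  obtain ⟨Z, hZ, hZX, z, hz, hzY, hsub⟩ := hex
  obtain ⟨f, hf⟩ := hK Y hY
  obtain ⟨g, hg⟩ := hK Z hZ
  have hzY' := hzY
  rw [mem_closedNbhd, not_or] at hzY'
  exact ⟨z, hZX hz, hzY'.1, (hf.insert_vertex hzY'.1 fun a b ha hb ha' hb' =>
    hf.eq_of_adj_of_erase_subset hY.1 hZ.1 hg hz hsub ha hb ha' hb').mem_Psi
      (hY.1.insert_vertex hzY'.2 hzY'.1)⟩

end Exchange

/-- For a triangle-free graph `G`, `Ψ(G)` is a greedoid iff all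
maximum matchings of `G` are uniquely restricted and the closed neighborhood of
every local maximum stable set induces a König-Egerváry graph. -/
theorem triangle_free_psi_greedoid_iff (G : SimpleGraph V)
    (h3 : ∀ (v : V) (c : G.Walk v v), c.IsCycle → c.length ≠ 3) :
    IsGreedoidFam (Psi G) ↔
      ((∀ M : Finset (Sym2 V), IsMaximumGMatching G M → UniquelyRestricted G M) ∧
        ∀ S ∈ Psi G, KonigEgervaryOn G (closedNbhd G S)) := by
  constructor
  · rintro ⟨-, hacc, -⟩
    refine ⟨fun M hM => hacc.uniquelyRestricted h3 hM, fun S hS => ?_⟩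
    obtain ⟨f, hf⟩ := hacc.exists_isNbhdMatching h3 hS
    exact hf.konigEgervaryOn hS.1
  · rintro ⟨hU, hKE⟩
    have hK : ∀ S ∈ Psi G, ∃ f, IsNbhdMatching G S f := fun S hS =>
      (hKE S hS).exists_isNbhdMatching hS
    have hacc := accessibleFam_Psi hU hK
    exact ⟨⟨∅, empty_mem_Psi G⟩, hacc, exchangeFam_Psi hacc hK⟩
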